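/- If Π̇ is an open set of stationary policies, then F(Π̇) is an open subset of the |S|(|A|−1)-dimensional affine subspace containing the image of F, and F restricted to Π̇ is a homeomorphism between G(Π̇) and F(Π̇). -/

import Mathlib

open scoped BigOperators

/-- A rewardless MDP with finite state and action spaces: transition kernel `T`,
initial distribution `I`, and discount factor `γ ∈ (0,1)`. -/
structure MDPnr (S A : Type) [Fintype S] [Fintype A] where
  T : S → A → S → ℝ
  T_nonneg : ∀ s a s', 0 ≤ T s a s'
  T_sum : ∀ s a, ∑ s', T s a s' = 1
  I : S → ℝ
  I_nonneg : ∀ s, 0 ≤ I s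
  I_sum : ∑ s, I s = 1
  γ : ℝ
  γ_pos : 0 < γ
  γ_lt_one : γ < 1

variable {S A : Type} [Fintype S] [Fintype A]

/-- A stationary policy: a distribution over actions in each state. -/
def IsPolicy (π : S → A → ℝ) : Prop :=
  (∀ s a, 0 ≤ π s a) ∧ ∀ s, ∑ a, π s a = 1

/-- The set of all stationary policies. -/
def allPolicies (S A : Type) [Fintype S] [Fintype A] : Set (S → A → ℝ) :=
  {π | IsPolicy π}

/-- The distribution over states at time `t` induced by policy `π`. -/
def stateDist (M : MDPnr S A) (π : S → A → ℝ) : ℕ → S → ℝ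
  | 0 => M.I
  | t + 1 => fun s' => ∑ s, ∑ a, stateDist M π t s * π s a * M.T s a s'

/-- Discounted state-action visit counts `F(π)(s,a) = ∑ₜ γᵗ P(Sₜ = s, Aₜ = a)`. -/
noncomputable def visit (M : MDPnr S A) (π : S → A → ℝ) : S → A → ℝ :=
  fun s a => ∑' t : ℕ, M.γ ^ t * stateDist M π t s * π s a

/-- The visit counts viewed as a vector in `ℝ^{S×A}`. -/
noncomputable def Fvec (M : MDPnr S A) (π : S → A → ℝ) : S × A → ℝ :=
  fun p => visit M π p.1 p.2

/-- The value `J_R(π) = ∑_{s,a} R(s,a) F(π)(s,a)` of a policy `π` under reward `R`. -/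
noncomputable def Jval (M : MDPnr S A) (R : S → A → ℝ) (π : S → A → ℝ) : ℝ :=
  ∑ s, ∑ a, R s a * visit M π s a

/-- `R₁, R₂` are unhackable on policy set `P` if no pair of policies is ordered
oppositely by the two reward functions. -/
def Unhackable (M : MDPnr S A) (P : Set (S → A → ℝ)) (R₁ R₂ : S → A → ℝ) : Prop :=
  ¬ ∃ π ∈ P, ∃ π' ∈ P, Jval M R₁ π < Jval M R₁ π' ∧ Jval M R₂ π > Jval M R₂ π'

/-- `R₁, R₂` are equivalent on `P` if they induce the same preference ordering. -/
def EquivalentOn (M : MDPnr S A) (P : Set (S → A → ℝ)) (R₁ R₂ : S → A → ℝ) : Prop :=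
  ∀ π ∈ P, ∀ π' ∈ P, (Jval M R₁ π ≤ Jval M R₁ π' ↔ Jval M R₂ π ≤ Jval M R₂ π')

/-- `R` is trivial on `P` if its value function is constant on `P`. -/
def TrivialOn (M : MDPnr S A) (P : Set (S → A → ℝ)) (R : S → A → ℝ) : Prop :=
  ∀ π ∈ P, ∀ π' ∈ P, Jval M R π = Jval M R π'

/-- The embedding `G(π)(s,a) = π(a|s)` of policies into `ℝ^{S×A}`. -/
def Gmap (π : S → A → ℝ) : S × A → ℝ := fun p => π p.1 p.2

/-- A set of stationary policies is open if its image under `G` is open in the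
smallest affine subspace of `ℝ^{S×A}` containing the `G`-image of all policies. -/
def OpenPolicySet (Pd : Set (S → A → ℝ)) : Prop :=
  Pd ⊆ allPolicies S A ∧
  IsOpen {x : (affineSpan ℝ (Gmap '' allPolicies S A) : Set (S × A → ℝ)) |
    (x : S × A → ℝ) ∈ Gmap '' Pd}

/-- Every state is reachable (with positive probability) under some policy. -/
def AllReachable (M : MDPnr S A) : Prop :=
  ∀ s : S, ∃ π : S → A → ℝ, IsPolicy π ∧ ∃ t : ℕ, 0 < stateDist M π t s

/-- `R₂` is a simplification of `R₁` relative to `P`. -/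
def Simplification (M : MDPnr S A) (P : Set (S → A → ℝ)) (R₁ R₂ : S → A → ℝ) : Prop :=
  (∀ π ∈ P, ∀ π' ∈ P,
    (Jval M R₁ π < Jval M R₁ π' → Jval M R₂ π ≤ Jval M R₂ π') ∧
    (Jval M R₁ π = Jval M R₁ π' → Jval M R₂ π = Jval M R₂ π')) ∧
  ∃ π ∈ P, ∃ π' ∈ P, Jval M R₂ π = Jval M R₂ π' ∧ Jval M R₁ π ≠ Jval M R₁ π'

open Finset Topology

lemma affineSpan_apply_eq {E F : Type*} [AddCommGroup E] [Module ℝ E] [AddCommGroup F]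
    [Module ℝ F] (f : E →ₗ[ℝ] F) {c : F} {X : Set E} (hX : ∀ x ∈ X, f x = c) {x : E}
    (hx : x ∈ affineSpan ℝ X) : f x = c := by
  refine affineSpan_induction (p := fun x => f x = c) hx hX fun r u v w hu hv hw => ?_
  simp [hu, hv, hw]

lemma sum_eq_one_of_mem_affineSpan {x : S × A → ℝ}
    (hx : x ∈ affineSpan ℝ (Gmap '' allPolicies S A)) (s : S) : ∑ a, x (s, a) = 1 := by
  have h := affineSpan_apply_eq (∑ a : A, LinearMap.proj (R := ℝ) (φ := fun _ : S × A => ℝ) (s, a))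
    (c := 1) (by rintro _ ⟨π, hπ, rfl⟩; simpa [Gmap] using hπ.2 s) hx
  simpa using h

lemma exists_small_perturbation {ι : Type*} [Finite ι] {c : ℝ} (hc : 0 < c) (v : ι → ℝ) :
    ∃ ε > 0, ∀ i, 0 ≤ c + ε * v i := by
  have h : ∀ᶠ ε in 𝓝[>] (0 : ℝ), ∀ i, 0 ≤ c + ε * v i := by
    rw [Filter.eventually_all]
    intro i
    have hcont : Continuous fun ε : ℝ => c + ε * v i := by fun_prop
    have := hcont.continuousAt.eventually (lt_mem_nhds (a := 0) (b := c + 0 * v i) (by simpa))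
    exact (this.filter_mono nhdsWithin_le_nhds).mono fun _ h => h.le
  obtain ⟨ε, h, hε⟩ := (h.and self_mem_nhdsWithin).exists
  exact ⟨ε, hε, h⟩

lemma mem_affineSpan_of_sum_eq_one [Nonempty A] {x : S × A → ℝ}
    (hx : ∀ s, ∑ a, x (s, a) = 1) : x ∈ affineSpan ℝ (Gmap '' allPolicies S A) := by
  have hA : (0 : ℝ) < Fintype.card A := by exact_mod_cast Fintype.card_pos
  set c : ℝ := (Fintype.card A : ℝ)⁻¹ with hc
  have hc0 : 0 < c := inv_pos.2 hA
  obtain ⟨ε, hε, hnn⟩ := exists_small_perturbation hc0 fun p => x p - c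
  have hcsum : ∑ _a : A, c = 1 := by simp [hc, hA.ne']
  have hu : (fun _ => c : S × A → ℝ) ∈ affineSpan ℝ (Gmap '' allPolicies S A) :=
    subset_affineSpan ℝ _ ⟨fun _ _ => c, ⟨fun _ _ => hc0.le, fun _ => hcsum⟩, rfl⟩
  have hv : (fun p => c + ε * (x p - c) : S × A → ℝ) ∈
      affineSpan ℝ (Gmap '' allPolicies S A) := by
    refine subset_affineSpan ℝ _ ⟨fun s a => c + ε * (x (s, a) - c),
      ⟨fun s a => hnn (s, a), fun s => ?_⟩, rfl⟩
    rw [sum_add_distrib, ← mul_sum, sum_sub_distrib, hcsum, hx s]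
    ring
  convert AffineMap.lineMap_mem (ε⁻¹) hu hv using 1
  ext p
  simp [AffineMap.lineMap_apply]
  field_simp
  ring

lemma OpenPolicySet.exists_isOpen [Nonempty A] {Pd : Set (S → A → ℝ)} (h : OpenPolicySet Pd) :
    ∃ U : Set (S × A → ℝ), IsOpen U ∧
      ∀ x, x ∈ Gmap '' Pd ↔ x ∈ U ∧ ∀ s, ∑ a, x (s, a) = 1 := by
  obtain ⟨hsub, hop⟩ := h
  obtain ⟨U, hU, hUeq⟩ := isOpen_induced_iff.1 hop
  have key : ∀ x (hx : x ∈ affineSpan ℝ (Gmap '' allPolicies S A)),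
      x ∈ U ↔ x ∈ Gmap '' Pd := fun x hx => Set.ext_iff.1 hUeq ⟨x, hx⟩
  refine ⟨U, hU, fun x => ⟨fun hx => ?_, fun hx => ?_⟩⟩
  · have hx' := subset_affineSpan ℝ _ (Set.image_mono hsub hx)
    exact ⟨(key x hx').2 hx, sum_eq_one_of_mem_affineSpan hx'⟩
  · exact (key x (mem_affineSpan_of_sum_eq_one hx.2)).1 hx.1

lemma OpenPolicySet.pos (hA : 1 < Fintype.card A) {Pd : Set (S → A → ℝ)}
    (h : OpenPolicySet Pd) {π : S → A → ℝ} (hπ : π ∈ Pd) (s : S) (a : A) : 0 < π s a := by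
  classical
  have : Nontrivial A := Fintype.one_lt_card_iff_nontrivial.1 hA
  obtain ⟨b, hb⟩ := exists_ne a
  obtain ⟨U, hU, hUiff⟩ := h.exists_isOpen
  refine ((h.1 hπ).1 s a).lt_of_ne fun h0 => ?_
  let y : ℝ → S × A → ℝ := fun δ => Gmap π - Pi.single (s, a) δ + Pi.single (s, b) δ
  have hy : Continuous y := by
    exact (continuous_const.sub (continuous_single (A := fun _ : S × A => ℝ) (s, a))).add
      (continuous_single (A := fun _ : S × A => ℝ) (s, b))
  have hy0 : y 0 ∈ U := by simpa [y] using ((hUiff _).1 ⟨π, hπ, rfl⟩).1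
  have hev : ∀ᶠ δ in 𝓝[>] (0 : ℝ), y δ ∈ U :=
    (hy.continuousAt.eventually (hU.mem_nhds hy0)).filter_mono nhdsWithin_le_nhds
  obtain ⟨δ, hδU, hδ⟩ := (hev.and self_mem_nhdsWithin).exists
  have hsum : ∀ s', ∑ a', y δ (s', a') = 1 := by
    intro s'
    have h1 := (h.1 hπ).2 s'
    by_cases hs : s' = s
    · subst hs
      simp [y, sum_add_distrib, sum_sub_distrib, Pi.single_apply, Gmap, h1]
    · simp [y, Gmap, h1, hs]
  obtain ⟨π', hπ', he⟩ := (hUiff (y δ)).2 ⟨hδU, hsum⟩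
  have h1 := (h.1 hπ').1 s a
  have h2 : π' s a = y δ (s, a) := congrFun he (s, a)
  have h3 : y δ (s, a) = -δ := by simp [y, Gmap, ← h0, hb.symm]
  have h4 : 0 < δ := hδ
  linarith

section

variable (M : MDPnr S A) {π : S → A → ℝ}

lemma stateDist_nonneg (hπ : IsPolicy π) (t : ℕ) (s : S) : 0 ≤ stateDist M π t s := by
  induction t generalizing s with
  | zero => exact M.I_nonneg s
  | succ t ih =>
    exact sum_nonneg fun s' _ => sum_nonneg fun a _ =>
      mul_nonneg (mul_nonneg (ih s') (hπ.1 s' a)) (M.T_nonneg _ _ _)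

lemma sum_stateDist (hπ : IsPolicy π) (t : ℕ) : ∑ s, stateDist M π t s = 1 := by
  induction t with
  | zero => exact M.I_sum
  | succ t ih =>
    simp only [stateDist]
    rw [sum_comm, ← ih]
    refine sum_congr rfl fun s _ => ?_
    rw [sum_comm]
    simp_rw [← mul_sum, M.T_sum, mul_one, ← mul_sum, hπ.2, mul_one]

lemma stateDist_le_one (hπ : IsPolicy π) (t : ℕ) (s : S) : stateDist M π t s ≤ 1 :=
  sum_stateDist M hπ t ▸
    single_le_sum (fun s' _ => stateDist_nonneg M hπ t s') (mem_univ s)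

lemma stateDist_pos_of_pos {π' : S → A → ℝ} (hπ : IsPolicy π) (hpos : ∀ s a, 0 < π s a)
    (hπ' : IsPolicy π') {t : ℕ} {s : S} (h : 0 < stateDist M π' t s) :
    0 < stateDist M π t s := by
  induction t generalizing s with
  | zero => exact h
  | succ t ih =>
    obtain ⟨s', -, h1⟩ := exists_lt_of_sum_lt (s := univ) (f := fun _ => (0 : ℝ))
      (by simpa [stateDist] using h)
    obtain ⟨a, -, h2⟩ := exists_lt_of_sum_lt (s := univ) (f := fun _ => (0 : ℝ))
      (by simpa using h1)
    have hd := stateDist_nonneg M hπ' t s'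
    have hT : 0 < M.T s' a s := pos_of_mul_pos_right h2 (mul_nonneg hd (hπ'.1 s' a))
    have hd' : 0 < stateDist M π' t s' :=
      pos_of_mul_pos_left (pos_of_mul_pos_left h2 hT.le) (hπ'.1 s' a)
    have hnn : ∀ s' a, 0 ≤ stateDist M π t s' * π s' a * M.T s' a s := fun s' a =>
      mul_nonneg (mul_nonneg (stateDist_nonneg M hπ t s') (hπ.1 s' a)) (M.T_nonneg _ _ _)
    calc 0 < stateDist M π t s' * π s' a * M.T s' a s :=
          mul_pos (mul_pos (ih hd') (hpos s' a)) hT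
      _ ≤ ∑ a, stateDist M π t s' * π s' a * M.T s' a s :=
          single_le_sum (f := fun a => stateDist M π t s' * π s' a * M.T s' a s)
            (fun a _ => hnn s' a) (mem_univ a)
      _ ≤ _ := single_le_sum
            (f := fun s' => ∑ a, stateDist M π t s' * π s' a * M.T s' a s)
            (fun s' _ => sum_nonneg fun a _ => hnn s' a) (mem_univ s')

/-- Discounted state visit counts `∑ₜ γᵗ P(Sₜ = s)`. -/
noncomputable def stateVisit (π : S → A → ℝ) (s : S) : ℝ :=
  ∑' t : ℕ, M.γ ^ t * stateDist M π t s

lemma norm_pow_mul_stateDist_le (hπ : IsPolicy π) (t : ℕ) (s : S) :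
    ‖M.γ ^ t * stateDist M π t s‖ ≤ M.γ ^ t := by
  have hγ := pow_nonneg M.γ_pos.le t
  rw [Real.norm_of_nonneg (mul_nonneg hγ (stateDist_nonneg M hπ t s))]
  exact mul_le_of_le_one_right hγ (stateDist_le_one M hπ t s)

lemma summable_pow_γ : Summable fun t : ℕ => M.γ ^ t :=
  summable_geometric_of_lt_one M.γ_pos.le M.γ_lt_one

lemma summable_stateVisit (hπ : IsPolicy π) (s : S) :
    Summable fun t : ℕ => M.γ ^ t * stateDist M π t s :=
  (summable_pow_γ M).of_norm_bounded fun t => norm_pow_mul_stateDist_le M hπ t s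

lemma visit_eq (π : S → A → ℝ) (s : S) (a : A) : visit M π s a = stateVisit M π s * π s a :=
  tsum_mul_right

lemma sum_Fvec (hπ : IsPolicy π) (s : S) : ∑ a, Fvec M π (s, a) = stateVisit M π s := by
  simp only [Fvec, visit_eq]
  rw [← mul_sum, hπ.2, mul_one]

lemma stateVisit_eq (hπ : IsPolicy π) (s' : S) :
    stateVisit M π s' = M.I s' + M.γ * ∑ s, ∑ a, stateVisit M π s * π s a * M.T s a s' := by
  have h : HasSum (fun t : ℕ => M.γ ^ (t + 1) * stateDist M π (t + 1) s')
      (M.γ * ∑ s, ∑ a, stateVisit M π s * π s a * M.T s a s') := by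
    have := (hasSum_sum fun s (_ : s ∈ (univ : Finset S)) =>
      hasSum_sum fun a (_ : a ∈ (univ : Finset A)) =>
      ((summable_stateVisit M hπ s).hasSum.mul_right (π s a)).mul_right (M.T s a s')).mul_left M.γ
    refine (funext fun t => ?_ :
      (fun t : ℕ => M.γ ^ (t + 1) * stateDist M π (t + 1) s') = _) ▸ this
    simp only [stateDist, mul_sum]
    exact sum_congr rfl fun s _ => sum_congr rfl fun a _ => by ring
  rw [stateVisit, (summable_stateVisit M hπ s').tsum_eq_zero_add, h.tsum_eq]
  simp [stateDist]

lemma eq_stateVisit (hπ : IsPolicy π) {d : S → ℝ}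
    (hd : ∀ s', d s' = M.I s' + M.γ * ∑ s, ∑ a, d s * π s a * M.T s a s') :
    d = stateVisit M π := by
  set e : S → ℝ := d - stateVisit M π with he
  have heq : ∀ s', e s' = M.γ * ∑ s, ∑ a, e s * π s a * M.T s a s' := by
    intro s'
    simp only [he, Pi.sub_apply, sub_mul, sum_sub_distrib]
    rw [mul_sub]
    linarith [hd s', stateVisit_eq M hπ s']
  have hle : ∑ s', |e s'| ≤ M.γ * ∑ s, |e s| := calc
    ∑ s', |e s'| ≤ ∑ s', M.γ * ∑ s, ∑ a, |e s| * π s a * M.T s a s' := by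
      refine sum_le_sum fun s' _ => ?_
      rw [heq s', abs_mul, abs_of_pos M.γ_pos]
      refine mul_le_mul_of_nonneg_left ?_ M.γ_pos.le
      refine (abs_sum_le_sum_abs _ _).trans (sum_le_sum fun s _ => ?_)
      refine (abs_sum_le_sum_abs _ _).trans (sum_le_sum fun a _ => ?_)
      rw [abs_mul, abs_mul, abs_of_nonneg (hπ.1 s a), abs_of_nonneg (M.T_nonneg s a s')]
    _ = M.γ * ∑ s, |e s| := by
      rw [← mul_sum, sum_comm]
      congr 1
      refine sum_congr rfl fun s _ => ?_
      rw [sum_comm]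
      simp_rw [← mul_sum, M.T_sum, mul_one, ← mul_sum, hπ.2, mul_one]
  have h0 : 0 ≤ ∑ s, |e s| := sum_nonneg fun s _ => abs_nonneg _
  have hz : ∑ s, |e s| = 0 := by nlinarith [M.γ_lt_one]
  rw [sum_eq_zero_iff_of_nonneg fun s _ => abs_nonneg _] at hz
  funext s
  exact sub_eq_zero.1 (abs_eq_zero.1 (hz s (mem_univ s)))

lemma stateVisit_pos (hreach : AllReachable M) (hπ : IsPolicy π) (hpos : ∀ s a, 0 < π s a)
    (s : S) : 0 < stateVisit M π s := by
  obtain ⟨π', hπ', t, ht⟩ := hreach s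
  exact (summable_stateVisit M hπ s).tsum_pos
    (fun t => mul_nonneg (pow_nonneg M.γ_pos.le t) (stateDist_nonneg M hπ t s)) t
    (mul_pos (pow_pos M.γ_pos t) (stateDist_pos_of_pos M hπ hpos hπ' ht))

lemma continuous_stateDist (t : ℕ) (s : S) :
    Continuous fun π : S → A → ℝ => stateDist M π t s := by
  induction t generalizing s with
  | zero => exact continuous_const
  | succ t ih => simp only [stateDist]; fun_prop

lemma continuousOn_Fvec : ContinuousOn (Fvec M) (allPolicies S A) := by
  have h : ∀ s, ContinuousOn (fun π => stateVisit M π s) (allPolicies S A) := fun s =>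
    continuousOn_tsum (fun t => (continuous_const.mul (continuous_stateDist M t s)).continuousOn)
      (summable_pow_γ M) fun t π hπ => norm_pow_mul_stateDist_le M hπ t s
  refine continuousOn_pi.2 fun p => ?_
  simp only [Fvec, visit_eq]
  exact (h p.1).mul (by fun_prop)

lemma flow_of_mem_affineSpan {x : S × A → ℝ}
    (hx : x ∈ affineSpan ℝ (Fvec M '' allPolicies S A)) (s' : S) :
    ∑ a, x (s', a) = M.I s' + M.γ * ∑ s, ∑ a, x (s, a) * M.T s a s' := by
  let P : S × A → (S × A → ℝ) →ₗ[ℝ] ℝ := LinearMap.proj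
  have h := affineSpan_apply_eq
    (∑ a, P (s', a) - M.γ • ∑ s, ∑ a, M.T s a s' • P (s, a)) (c := M.I s') (by
      rintro _ ⟨π, hπ, rfl⟩
      have h1 := sum_Fvec M hπ s'
      have h2 := stateVisit_eq M hπ s'
      simp only [P, LinearMap.sub_apply, LinearMap.smul_apply, LinearMap.sum_apply,
        LinearMap.proj_apply, smul_eq_mul, h1, mul_comm (M.T _ _ _)]
      simp only [Fvec, visit_eq]
      linarith) hx
  simp only [P, LinearMap.sub_apply, LinearMap.smul_apply, LinearMap.sum_apply,
    LinearMap.proj_apply, smul_eq_mul, mul_comm (M.T _ _ _)] at h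
  linarith

end

/-- The conditional action probabilities `x(s,a) / ∑ₐ x(s,a)`. -/
noncomputable def condProb (x : S × A → ℝ) : S × A → ℝ := fun p => x p / ∑ a, x (p.1, a)

lemma continuousOn_condProb {S A : Type} [Fintype A] :
    ContinuousOn (condProb (S := S) (A := A)) {x | ∀ s, 0 < ∑ a, x (s, a)} := by
  refine continuousOn_pi.2 fun p => ?_
  exact ContinuousOn.div (by fun_prop) (by fun_prop) fun x hx => (hx p.1).ne'

lemma isOpen_sum_pos : IsOpen {x : S × A → ℝ | ∀ s, 0 < ∑ a, x (s, a)} := by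
  simp only [Set.ofPred_forall]
  exact isOpen_iInter_of_finite fun s => isOpen_lt continuous_const (by fun_prop)

lemma sum_condProb {S A : Type} [Fintype A] {x : S × A → ℝ} {s : S}
    (hx : 0 < ∑ a, x (s, a)) :
    ∑ a, condProb x (s, a) = 1 := by
  simp only [condProb]
  rw [← sum_div, div_self hx.ne']

lemma condProb_Fvec (M : MDPnr S A) {π : S → A → ℝ} (hπ : IsPolicy π)
    (h : ∀ s, 0 < stateVisit M π s) : condProb (Fvec M π) = Gmap π := by
  funext ⟨s, a⟩
  simp only [condProb, sum_Fvec M hπ]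
  simp only [Fvec, visit_eq, Gmap]
  rw [mul_div_cancel_left₀ _ (h s).ne']

lemma eq_Fvec_of_condProb_eq (M : MDPnr S A) {π : S → A → ℝ} (hπ : IsPolicy π)
    {x : S × A → ℝ} (hx : x ∈ affineSpan ℝ (Fvec M '' allPolicies S A))
    (hpos : ∀ s, 0 < ∑ a, x (s, a)) (h : condProb x = Gmap π) : x = Fvec M π := by
  have hxp : ∀ s a, x (s, a) = (∑ a, x (s, a)) * π s a := fun s a => by
    have h1 : x (s, a) / ∑ a, x (s, a) = π s a := congrFun h (s, a)
    rw [← h1, mul_div_cancel₀ _ (hpos s).ne']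
  have hd := eq_stateVisit M hπ (d := fun s => ∑ a, x (s, a)) fun s' => by
    simp only [← hxp]
    exact flow_of_mem_affineSpan M hx s'
  funext ⟨s, a⟩
  rw [hxp, Fvec, visit_eq, ← hd]

/-- If `Pd` is an open set of stationary policies, then `F(Pd)` is open in
the affine subspace containing the image of `F`, and `F` is a homeomorphism between
`G(Pd)` and `F(Pd)`. -/
theorem visit_open_and_homeomorph
    (M : MDPnr S A) (hA : 1 < Fintype.card A) (hreach : AllReachable M)
    (Pd : Set (S → A → ℝ)) (hopen : OpenPolicySet Pd) :
    IsOpen {x : (affineSpan ℝ (Fvec M '' allPolicies S A) : Set (S × A → ℝ)) |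
        (x : S × A → ℝ) ∈ Fvec M '' Pd} ∧
      ∃ h : (Gmap '' Pd : Set (S × A → ℝ)) ≃ₜ (Fvec M '' Pd : Set (S × A → ℝ)),
        ∀ (π : S → A → ℝ) (hπ : π ∈ Pd),
          (h ⟨Gmap π, ⟨π, hπ, rfl⟩⟩).val = Fvec M π := by
  have : Nonempty A := Fintype.card_pos_iff.1 (by lia)
  obtain ⟨U, hU, hUiff⟩ := hopen.exists_isOpen
  have hvpos : ∀ π ∈ Pd, ∀ s, 0 < stateVisit M π s := fun π hπ =>
    stateVisit_pos M hreach (hopen.1 hπ) (hopen.pos hA hπ)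
  have hsum : ∀ π ∈ Pd, ∀ s, 0 < ∑ a, Fvec M π (s, a) := fun π hπ s => by
    rw [sum_Fvec M (hopen.1 hπ)]
    exact hvpos π hπ s
  have hnorm : ∀ π ∈ Pd, condProb (Fvec M π) = Gmap π := fun π hπ =>
    condProb_Fvec M (hopen.1 hπ) (hvpos π hπ)
  refine ⟨?_, ?_⟩
  · refine isOpen_induced_iff.2
      ⟨_, continuousOn_condProb.isOpen_inter_preimage isOpen_sum_pos hU, ?_⟩
    ext ⟨x, hx⟩
    constructor
    · rintro ⟨hpos, hxU⟩
      obtain ⟨π, hπ, he⟩ := (hUiff (condProb x)).2 ⟨hxU, fun s => sum_condProb (hpos s)⟩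
      exact ⟨π, hπ, (eq_Fvec_of_condProb_eq M (hopen.1 hπ) hx hpos he.symm).symm⟩
    · rintro ⟨π, hπ, rfl⟩
      refine ⟨hsum π hπ, ?_⟩
      rw [Set.mem_preimage, hnorm π hπ]
      exact ((hUiff _).1 ⟨π, hπ, rfl⟩).1
  · have hmem : ∀ y : (Gmap '' Pd : Set (S × A → ℝ)), (fun s a => y.1 (s, a)) ∈ Pd := by
      rintro ⟨_, π, hπ, rfl⟩
      exact hπ
    refine ⟨{ toFun := fun y => ⟨Fvec M fun s a => y.1 (s, a), _, hmem y, rfl⟩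
              invFun := fun x => ⟨condProb x.1, by
                obtain ⟨_, π, hπ, rfl⟩ := x
                exact ⟨π, hπ, (hnorm π hπ).symm⟩⟩
              left_inv := ?_
              right_inv := ?_
              continuous_toFun := ?_
              continuous_invFun := ?_ }, fun π hπ => rfl⟩
    · rintro ⟨_, π, hπ, rfl⟩
      exact Subtype.ext (hnorm π hπ)
    · rintro ⟨_, π, hπ, rfl⟩
      refine Subtype.ext ?_
      change Fvec M (fun s a => condProb (Fvec M π) (s, a)) = Fvec M π
      rw [hnorm π hπ]
      rfl
    · exact ((continuousOn_Fvec M).comp_continuous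
        (continuous_pi fun s => continuous_pi fun a =>
          (continuous_apply (s, a)).comp continuous_subtype_val)
        fun y => hopen.1 (hmem y)).subtype_mk _
    · refine (continuousOn_condProb.comp_continuous continuous_subtype_val ?_).subtype_mk _
      rintro ⟨_, π, hπ, rfl⟩
      exact hsum π hπ
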